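/- Let X be a finite-dimensional real normed space, M an open neighborhood of 0 in X, and f : M → ℝ a C¹ function with f(0) = 0 such that 0 is a strict local minimum of f and an isolated critical point of f. Then for every neighborhood W of 0 there exists τ > 0 such that for every ε ∈ (0, τ) the connected component W_ε of {u ∈ M : f(u) ≤ ε} containing 0 is a compact neighborhood of 0 contained in W which contains no critical point of f other than 0; moreover, as ε ↓ 0 the sets W_ε form a neighborhood base of 0. -/

import Mathlib

open Metric Set Topology Filter

/-- If `f` is positive on a small punctured closed ball around `0` and `f 0 = 0`, then the
components at `0` of low sublevel sets of `f` are compact neighborhoods of `0` inside the ball. -/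
theorem exists_connectedComponentIn_sublevel_subset_ball
    {X : Type*} [NormedAddCommGroup X] [NormedSpace ℝ X] [FiniteDimensional ℝ X]
    {M : Set X} {f : X → ℝ} (hcont : ContinuousOn f M) (hf0 : f 0 = 0) {ρ : ℝ} (hρ : 0 < ρ)
    (hM : closedBall (0 : X) ρ ⊆ M) (hpos : ∀ u ∈ closedBall (0 : X) ρ, u ≠ 0 → 0 < f u) :
    ∃ τ > 0, ∀ e ∈ Ioo (0 : ℝ) τ,
      IsCompact (connectedComponentIn {u ∈ M | f u ≤ e} 0) ∧
      connectedComponentIn {u ∈ M | f u ≤ e} 0 ∈ 𝓝 (0 : X) ∧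
      connectedComponentIn {u ∈ M | f u ≤ e} 0 ⊆ ball 0 ρ := by
  have : ProperSpace X := FiniteDimensional.proper_real X
  have hcontB : ContinuousOn f (closedBall 0 ρ) := hcont.mono hM
  obtain ⟨τ, hτ, hsphere⟩ : ∃ τ > 0, ∀ u ∈ sphere (0 : X) ρ, τ ≤ f u := by
    rcases (sphere (0 : X) ρ).eq_empty_or_nonempty with h | h
    · exact ⟨1, one_pos, by simp [h]⟩
    · obtain ⟨x, hx, hmin⟩ := (isCompact_sphere (0 : X) ρ).exists_isMinOn h
        (hcontB.mono sphere_subset_closedBall)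
      exact ⟨f x, hpos x (sphere_subset_closedBall hx) (ne_of_mem_sphere hx hρ.ne'),
        fun u hu => hmin hu⟩
  refine ⟨τ, hτ, fun e he => ?_⟩
  have h0S : (0 : X) ∈ {u ∈ M | f u ≤ e} :=
    ⟨hM (mem_closedBall_self hρ.le), by rw [hf0]; exact he.1.le⟩
  have hCS := connectedComponentIn_subset {u ∈ M | f u ≤ e} 0
  have h0C := mem_connectedComponentIn h0S
  have hpre : IsPreconnected (connectedComponentIn {u ∈ M | f u ≤ e} 0) :=
    isPreconnected_connectedComponentIn
  have hball : connectedComponentIn {u ∈ M | f u ≤ e} 0 ⊆ ball 0 ρ := by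
    intro u hu
    rw [mem_ball_zero_iff]
    by_contra! hle
    obtain ⟨v, hv, hvρ⟩ := hpre.intermediate_value h0C hu continuous_norm.continuousOn
      ⟨by simpa using hρ.le, hle⟩
    exact absurd ((hsphere v (by simpa using hvρ)).trans (hCS hv).2) (not_le.2 he.2)
  refine ⟨?_, ?_, hball⟩
  · refine (isCompact_closedBall (0 : X) ρ).of_isClosed_subset ?_
      (hball.trans ball_subset_closedBall)
    have hclB : closure (connectedComponentIn {u ∈ M | f u ≤ e} 0) ⊆ closedBall 0 ρ :=
      closure_minimal (hball.trans ball_subset_closedBall) isClosed_closedBall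
    refine isClosed_of_closure_subset
      (hpre.closure.subset_connectedComponentIn (subset_closure h0C) fun u hu => ?_)
    have hcl : IsClosed (closedBall (0 : X) ρ ∩ f ⁻¹' Iic e) :=
      hcontB.preimage_isClosed_of_isClosed isClosed_closedBall isClosed_Iic
    have hsub : connectedComponentIn {u ∈ M | f u ≤ e} 0 ⊆ closedBall 0 ρ ∩ f ⁻¹' Iic e :=
      fun v hv => ⟨ball_subset_closedBall (hball hv), (hCS hv).2⟩
    exact ⟨hM (hclB hu), (closure_minimal hsub hcl hu).2⟩
  · have hlow : {u ∈ M | f u ≤ e} ∈ 𝓝 (0 : X) := by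
      have hMn : M ∈ 𝓝 (0 : X) := mem_of_superset (closedBall_mem_nhds 0 hρ) hM
      have hlt : ∀ᶠ u in 𝓝 (0 : X), f u < e :=
        (hcont.continuousAt hMn).eventually_lt_const (by rw [hf0]; exact he.1)
      filter_upwards [hMn, hlt] with u hu hu' using ⟨hu, hu'.le⟩
    obtain ⟨δ, hδ, hsub⟩ := Metric.mem_nhds_iff.1 hlow
    exact mem_of_superset (ball_mem_nhds 0 hδ)
      ((convex_ball (0 : X) δ).isPreconnected.subset_connectedComponentIn
        (mem_ball_self hδ) hsub)

/-- **Claim B**: Let `X` be a finite dimensional real normed space, `M` an open neighborhood of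
`0` and `f : M → ℝ` a `C¹` function with `f 0 = 0` such that `0` is a strict local minimum of
`f` and an isolated critical point of `f`.  Then for every neighborhood `W` of `0` there is
`τ > 0` such that for every `e ∈ (0, τ)` the connected component `W_e` of `{u ∈ M | f u ≤ e}`
containing `0` is a compact neighborhood of `0` contained in `W` which contains no critical
point of `f` other than `0`; moreover the sets `W_e` form a neighborhood base of `0`. -/
theorem stmt_5
    {X : Type*} [NormedAddCommGroup X] [NormedSpace ℝ X] [FiniteDimensional ℝ X]
    (M : Set X) (hM : IsOpen M) (h0M : (0 : X) ∈ M)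
    (f : X → ℝ) (f' : X → (X →L[ℝ] ℝ))
    (hdiff : ∀ u ∈ M, HasFDerivAt f (f' u) u)
    (hcont : ContinuousOn f M) (hcont' : ContinuousOn f' M)
    (hf0 : f 0 = 0)
    (hstrictmin : ∃ r > 0, ball (0 : X) r ⊆ M ∧ ∀ u ∈ ball (0 : X) r, u ≠ 0 → 0 < f u)
    (hisol : ∃ r > 0, ball (0 : X) r ⊆ M ∧ ∀ u ∈ ball (0 : X) r, u ≠ 0 → f' u ≠ 0) :
    ∀ W ∈ 𝓝 (0 : X), ∃ τ > 0,
      (∀ e ∈ Ioo (0 : ℝ) τ,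
        IsCompact (connectedComponentIn {u ∈ M | f u ≤ e} 0) ∧
        connectedComponentIn {u ∈ M | f u ≤ e} 0 ∈ 𝓝 (0 : X) ∧
        connectedComponentIn {u ∈ M | f u ≤ e} 0 ⊆ W ∧
        ∀ u ∈ connectedComponentIn {u ∈ M | f u ≤ e} 0, u ≠ 0 → f' u ≠ 0) ∧
      (∀ V ∈ 𝓝 (0 : X), ∃ e ∈ Ioo (0 : ℝ) τ,
        connectedComponentIn {u ∈ M | f u ≤ e} 0 ⊆ V) := by
  obtain ⟨r, hr, hrM, hpos⟩ := hstrictmin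
  obtain ⟨s, hs, -, hcrit⟩ := hisol
  have key : ∀ W ∈ 𝓝 (0 : X), ∃ τ > 0, ∀ e ∈ Ioo (0 : ℝ) τ,
      IsCompact (connectedComponentIn {u ∈ M | f u ≤ e} 0) ∧
      connectedComponentIn {u ∈ M | f u ≤ e} 0 ∈ 𝓝 (0 : X) ∧
      connectedComponentIn {u ∈ M | f u ≤ e} 0 ⊆ W ∩ ball 0 s := by
    intro W hW
    obtain ⟨ρ, hρ, hsub⟩ := Metric.nhds_basis_closedBall.mem_iff.1
      (inter_mem (inter_mem hW (ball_mem_nhds 0 hs)) (ball_mem_nhds (0 : X) hr))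
    obtain ⟨τ, hτ, h⟩ := exists_connectedComponentIn_sublevel_subset_ball hcont hf0 hρ
      (fun u hu => hrM (hsub hu).2) (fun u hu => hpos u (hsub hu).2)
    exact ⟨τ, hτ, fun e he => ⟨(h e he).1, (h e he).2.1,
      fun u hu => (hsub (ball_subset_closedBall ((h e he).2.2 hu))).1⟩⟩
  intro W hW
  obtain ⟨τ, hτ, h⟩ := key W hW
  refine ⟨τ, hτ, fun e he => ?_, fun V hV => ?_⟩
  · obtain ⟨hcomp, hnhds, hsub⟩ := h e he
    exact ⟨hcomp, hnhds, fun u hu => (hsub hu).1, fun u hu => hcrit u (hsub hu).2⟩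
  · obtain ⟨τ', hτ', h'⟩ := key V hV
    obtain ⟨e, he, he'⟩ := exists_between (lt_min hτ hτ')
    exact ⟨e, ⟨he, he'.trans_le (min_le_left _ _)⟩,
      fun u hu => ((h' e ⟨he, he'.trans_le (min_le_right _ _)⟩).2.2 hu).1⟩
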